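/- arXiv:1301.6379 — 2 statements merged into one kernel-verified Lean document; each statement's English description precedes it below -/
import Mathlib

section
/- Let $a<b$ and let $S=(\alpha_1,\alpha_2,\alpha_3,\alpha_4):(a,b)\to\mathbb{R}^4$ be a differentiable curve with $|S(u)|=1$, $\alpha_2(u),\alpha_3(u),\alpha_4(u)\neq 0$ and $D(u):=2\alpha_1\alpha_2\alpha_4-\alpha_3(\alpha_4^2-\alpha_2^2)\neq 0$ for all $u$, satisfying $S'(u)=W(S(u))$. Then for all $u\in(a,b)$: $\dfrac{d}{du}\left(\dfrac{\alpha_1\alpha_2\alpha_4}{2\alpha_1\alpha_2\alpha_4-\alpha_3(\alpha_4^2-\alpha_2^2)}\right)=\dfrac{\alpha_1\alpha_3}{2\alpha_1\alpha_2\alpha_4-\alpha_3(\alpha_4^2-\alpha_2^2)}$. -/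
/-- First component of the vector field `V` (right-hand side of system (2)). -/
noncomputable def V1 (a1 a2 _a3 a4 : ℝ) : ℝ := 1/2 * (a1^2/a2^2 - a1^2/a4^2)

/-- Second component of the vector field `V`. -/
noncomputable def V2 (a1 a2 a3 a4 : ℝ) : ℝ :=
  1/2 * ((a4^2 - a2^2 + a3^2)/(a3*a4) - a1/a2)

/-- Third component of the vector field `V`. -/
noncomputable def V3 (_a1 a2 a3 a4 : ℝ) : ℝ := (a2^2 + a4^2 - a3^2)/(a2*a4)

/-- Fourth component of the vector field `V`. -/
noncomputable def V4 (a1 a2 a3 a4 : ℝ) : ℝ :=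
  1/2 * ((a2^2 - a4^2 + a3^2)/(a2*a3) + a1/a4)

/-- Euclidean inner product `⟨V(S), S⟩`. -/
noncomputable def ipVS (a1 a2 a3 a4 : ℝ) : ℝ :=
  V1 a1 a2 a3 a4 * a1 + V2 a1 a2 a3 a4 * a2 +
  V3 a1 a2 a3 a4 * a3 + V4 a1 a2 a3 a4 * a4

/-- Components of the tangential vector field `W(S) = V(S) - ⟨V(S),S⟩ S`. -/
noncomputable def W1 (a1 a2 a3 a4 : ℝ) : ℝ := V1 a1 a2 a3 a4 - ipVS a1 a2 a3 a4 * a1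
noncomputable def W2 (a1 a2 a3 a4 : ℝ) : ℝ := V2 a1 a2 a3 a4 - ipVS a1 a2 a3 a4 * a2
noncomputable def W3 (a1 a2 a3 a4 : ℝ) : ℝ := V3 a1 a2 a3 a4 - ipVS a1 a2 a3 a4 * a3
noncomputable def W4 (a1 a2 a3 a4 : ℝ) : ℝ := V4 a1 a2 a3 a4 - ipVS a1 a2 a3 a4 * a4

/-- The vector field `V` on `ℝ⁴` (as a quadruple). -/
noncomputable def Vv (S : ℝ × ℝ × ℝ × ℝ) : ℝ × ℝ × ℝ × ℝ :=
  (V1 S.1 S.2.1 S.2.2.1 S.2.2.2, V2 S.1 S.2.1 S.2.2.1 S.2.2.2,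
   V3 S.1 S.2.1 S.2.2.1 S.2.2.2, V4 S.1 S.2.1 S.2.2.1 S.2.2.2)

/-- The vector field `W` on `ℝ⁴` (as a quadruple). -/
noncomputable def Wv (S : ℝ × ℝ × ℝ × ℝ) : ℝ × ℝ × ℝ × ℝ :=
  (W1 S.1 S.2.1 S.2.2.1 S.2.2.2, W2 S.1 S.2.1 S.2.2.1 S.2.2.2,
   W3 S.1 S.2.1 S.2.2.1 S.2.2.2, W4 S.1 S.2.1 S.2.2.1 S.2.2.2)

/-- Euclidean inner product `⟨V(S),S⟩` in quadruple form. -/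
noncomputable def ipv (S : ℝ × ℝ × ℝ × ℝ) : ℝ :=
  ipVS S.1 S.2.1 S.2.2.1 S.2.2.2

/-- Relation 2) of Lemma 8: along a solution of system (6) on the unit
sphere with nonvanishing denominator `D = 2α₁α₂α₄ - α₃(α₄² - α₂²)`, one has
`(α₁α₂α₄ / D)' = α₁α₃ / D`. -/
theorem statement1 (a b : ℝ) (hab : a < b) (a1 a2 a3 a4 : ℝ → ℝ)
    (hnorm : ∀ u ∈ Set.Ioo a b,
      (a1 u)^2 + (a2 u)^2 + (a3 u)^2 + (a4 u)^2 = 1)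
    (h2 : ∀ u ∈ Set.Ioo a b, a2 u ≠ 0)
    (h3 : ∀ u ∈ Set.Ioo a b, a3 u ≠ 0)
    (h4 : ∀ u ∈ Set.Ioo a b, a4 u ≠ 0)
    (hD : ∀ u ∈ Set.Ioo a b,
      2 * a1 u * a2 u * a4 u - a3 u * ((a4 u)^2 - (a2 u)^2) ≠ 0)
    (hd1 : ∀ u ∈ Set.Ioo a b, HasDerivAt a1 (W1 (a1 u) (a2 u) (a3 u) (a4 u)) u)
    (hd2 : ∀ u ∈ Set.Ioo a b, HasDerivAt a2 (W2 (a1 u) (a2 u) (a3 u) (a4 u)) u)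
    (hd3 : ∀ u ∈ Set.Ioo a b, HasDerivAt a3 (W3 (a1 u) (a2 u) (a3 u) (a4 u)) u)
    (hd4 : ∀ u ∈ Set.Ioo a b, HasDerivAt a4 (W4 (a1 u) (a2 u) (a3 u) (a4 u)) u) :
    ∀ u ∈ Set.Ioo a b,
      HasDerivAt
        (fun v => a1 v * a2 v * a4 v /
          (2 * a1 v * a2 v * a4 v - a3 v * ((a4 v)^2 - (a2 v)^2)))
        (a1 u * a3 u /
          (2 * a1 u * a2 u * a4 u - a3 u * ((a4 u)^2 - (a2 u)^2))) u := by
  intro u hu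
  have e2 := h2 u hu
  have e3 := h3 u hu
  have e4 := h4 u hu
  have eD := hD u hu
  have d1 := hd1 u hu
  have d2 := hd2 u hu
  have d3 := hd3 u hu
  have d4 := hd4 u hu
  have hN := (d1.mul d2).mul d4
  have hQ := d3.mul ((d4.pow 2).sub (d2.pow 2))
  have hNv : (W1 (a1 u) (a2 u) (a3 u) (a4 u) * a2 u + a1 u * W2 (a1 u) (a2 u) (a3 u) (a4 u)) * a4 u
      + a1 u * a2 u * W4 (a1 u) (a2 u) (a3 u) (a4 u)
      = a1 u * a3 u - 3 * ipVS (a1 u) (a2 u) (a3 u) (a4 u) * (a1 u * a2 u * a4 u) := by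
    unfold W1 W2 W4
    generalize ipVS (a1 u) (a2 u) (a3 u) (a4 u) = k
    unfold V1 V2 V4
    field_simp
    ring
  have hQv : W3 (a1 u) (a2 u) (a3 u) (a4 u) * ((a4 u)^2 - (a2 u)^2)
      + a3 u * (2 * a4 u * W4 (a1 u) (a2 u) (a3 u) (a4 u)
        - 2 * a2 u * W2 (a1 u) (a2 u) (a3 u) (a4 u))
      = 2 * (a1 u * a3 u) - 3 * ipVS (a1 u) (a2 u) (a3 u) (a4 u)
        * (a3 u * ((a4 u)^2 - (a2 u)^2)) := by
    unfold W2 W3 W4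
    generalize ipVS (a1 u) (a2 u) (a3 u) (a4 u) = k
    unfold V2 V3 V4
    field_simp
    ring
  have hN' : HasDerivAt (fun v => a1 v * a2 v * a4 v) _ u := hN.congr_deriv hNv
  have hQ' : HasDerivAt (fun v => a3 v * ((a4 v)^2 - (a2 v)^2)) _ u :=
    hQ.congr_deriv (Eq.trans (by simp) hQv)
  have hDen : HasDerivAt
      (fun v => 2 * a1 v * a2 v * a4 v - a3 v * ((a4 v)^2 - (a2 v)^2)) _ u :=
    ((hN'.const_mul 2).sub hQ').congr_of_eventuallyEq
      (Filter.Eventually.of_forall fun v => by simp; ring)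
  refine (hN'.div hDen eD).congr_deriv ?_
  rw [div_eq_div_iff (pow_ne_zero 2 eD) eD]
  ring
end

section
/- Let $\mu,\lambda>0$ with $\mu^2+2\lambda^2=1$, and set $S_0=(\mu,\lambda,0,\lambda)$. Then there exist $\varepsilon>0$ and a differentiable curve $S=(\alpha_1,\alpha_2,\alpha_3,\alpha_4):(0,\varepsilon)\to\mathbb{R}^4$ with $|S(u)|=1$, $S'(u)=W(S(u))$, $\alpha_3(u)>0$ and $\alpha_4(u)>\alpha_2(u)>0$ for all $u\in(0,\varepsilon)$, and $S(u)\to S_0$ as $u\to 0^+$. Moreover this trajectory is unique: if $\tilde S:(0,\tilde\varepsilon)\to\mathbb{R}^4$ is another curve with the same properties, then $S(u)=\tilde S(u)$ for all $u\in(0,\min(\varepsilon,\tilde\varepsilon))$. -/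
section
open Filter Topology Set

theorem aux_lip {E : Type*} [NormedAddCommGroup E] [NormedSpace ℝ E]
    (H : ℝ × E → E) (X0 : E) (A : E →L[ℝ] E) (hH : ContDiffAt ℝ 1 H (0, X0))
    (hA : HasFDerivAt (fun x => H (0, x)) A X0) (hA2 : ‖A‖ < 2) :
    ∃ L : ℝ, 0 ≤ L ∧ L < 2 ∧ ∃ r > 0, ContinuousOn H (Icc 0 r ×ˢ Metric.closedBall X0 r) ∧
      ∀ u ∈ Icc (0:ℝ) r, ∀ x ∈ Metric.closedBall X0 r, ∀ y ∈ Metric.closedBall X0 r,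
        ‖H (u, x) - H (u, y)‖ ≤ L * ‖x - y‖ := by
  have hs := hH.hasStrictFDerivAt one_ne_zero
  set B := fderiv ℝ H (0, X0) with hB
  have hAB : ∀ z, A z = B (0, z) := by
    intro z
    have h1 : HasFDerivAt (fun x : E => ((0:ℝ), x)) (ContinuousLinearMap.inr ℝ ℝ E) X0 :=
      hasFDerivAt_prodMk_right 0 X0
    have h2 := HasFDerivAt.comp X0 (f := fun x : E => ((0:ℝ), x)) hs.hasFDerivAt h1
    have h3 := h2.unique hA
    rw [← h3]; simp
  have hcont : ∀ᶠ p in 𝓝 ((0:ℝ), X0), ContinuousAt H p := by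
    have := hH.eventually (by simp)
    exact this.mono fun p hp => hp.continuousAt
  set d := (2 - ‖A‖) / 2 with hd
  have hd0 : 0 < d := by rw [hd]; linarith
  have h4 := (hs.isLittleO.def hd0)
  rw [nhds_prod_eq] at h4
  obtain ⟨S1, hS1, S2, hS2, h4⟩ := mem_prod_iff.1 h4
  set S := S1 ∩ S2 with hSdef
  have hS : S ∈ 𝓝 ((0:ℝ), X0) := inter_mem hS1 hS2
  have h5 : S ∩ {p | ContinuousAt H p} ∈ 𝓝 ((0:ℝ), X0) := inter_mem hS hcont
  obtain ⟨r, hr, hr2⟩ := Metric.nhds_basis_closedBall.mem_iff.1 h5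
  have hmem : ∀ u ∈ Icc (0:ℝ) r, ∀ x ∈ Metric.closedBall X0 r, (u, x) ∈ Metric.closedBall ((0:ℝ), X0) r := by
    intro u hu x hx
    rw [Metric.mem_closedBall, Prod.dist_eq]
    refine max_le ?_ hx
    simp [abs_of_nonneg hu.1, hu.2]
  refine ⟨‖A‖ + d, by positivity, by rw [hd]; linarith, r, hr, ?_, ?_⟩
  · rintro ⟨u, x⟩ ⟨hu, hx⟩
    exact ContinuousAt.continuousWithinAt (hr2 (hmem u hu x hx)).2
  · intro u hu x hx y hy
    have := h4 (mk_mem_prod (hr2 (hmem u hu x hx)).1.1 (hr2 (hmem u hu y hy)).1.2)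
    simp only [mem_ofPred_eq, Prod.mk_sub_mk, sub_self] at this
    rw [← hAB] at this
    have e : ‖((0:ℝ), x - y)‖ = ‖x - y‖ := by simp [Prod.norm_def]
    rw [e] at this
    have h6 := A.le_opNorm (x - y)
    calc _ = ‖(H (u, x) - H (u, y) - A (x - y)) + A (x - y)‖ := by simp
      _ ≤ _ := norm_add_le _ _
      _ ≤ _ := by linarith

theorem aux_uniq {E : Type*} [NormedAddCommGroup E] [NormedSpace ℝ E]
    (H : ℝ × E → E) (X0 : E) (L r δ : ℝ) (hL0 : 0 ≤ L) (hL : L < 2)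
    (hδr : δ ≤ r) 
    (hlip : ∀ u ∈ Icc (0:ℝ) r, ∀ x ∈ Metric.closedBall X0 r, ∀ y ∈ Metric.closedBall X0 r,
        ‖H (u, x) - H (u, y)‖ ≤ L * ‖x - y‖)
    (X Y : ℝ → E) (hX : ∀ u ∈ Ioo 0 δ, X u ∈ Metric.closedBall X0 r)
    (hY : ∀ u ∈ Ioo 0 δ, Y u ∈ Metric.closedBall X0 r)
    (hX' : ∀ u ∈ Ioo 0 δ, HasDerivAt X (u⁻¹ • (H (u, X u) - (2:ℝ) • X u)) u)
    (hY' : ∀ u ∈ Ioo 0 δ, HasDerivAt Y (u⁻¹ • (H (u, Y u) - (2:ℝ) • Y u)) u) :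
    ∀ u ∈ Ioo 0 δ, X u = Y u := by
  have step : ∀ M : ℝ, (∀ u ∈ Ioo 0 δ, ‖X u - Y u‖ ≤ M) → ∀ u ∈ Ioo 0 δ, ‖X u - Y u‖ ≤ (L/2) * M := by
    intro M hM u hu
    have hder : ∀ t ∈ Ioo 0 δ, HasDerivAt (fun t : ℝ => t^2 • (X t - Y t))
        (t • (H (t, X t) - H (t, Y t))) t := by
      intro t ht
      have := (hasDerivAt_pow 2 t).smul ((hX' t ht).sub (hY' t ht))
      refine this.congr_deriv ?_
      have ht0 : t ≠ 0 := ht.1.ne'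
      have e : t ^ 2 * t⁻¹ = t := by field_simp
      simp only [Nat.cast_ofNat, Pi.sub_apply, ← smul_sub, smul_smul, e]
      simp only [smul_sub]
      module
    have hc : ContinuousOn (fun t : ℝ => t^2 • (X t - Y t)) (Icc 0 u) := by
      intro t ht
      rcases eq_or_lt_of_le ht.1 with h | h
      · subst h
        have : Tendsto (fun t : ℝ => t^2 • (X t - Y t)) (𝓝[Icc 0 u] 0) (𝓝 0) := by
          have hb : ∀ᶠ t in 𝓝[Icc 0 u] (0:ℝ), ‖t^2 • (X t - Y t)‖ ≤ t^2 * M := by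
            filter_upwards [self_mem_nhdsWithin] with t ht
            rcases eq_or_lt_of_le ht.1 with h | h
            · subst h; simp
            · rw [norm_smul, norm_pow, Real.norm_eq_abs, sq_abs]
              gcongr
              exact hM t ⟨h, ht.2.trans_lt hu.2⟩
          refine squeeze_zero_norm' hb ?_
          have : ContinuousAt (fun t : ℝ => t^2 * M) 0 := by fun_prop
          have := this.tendsto.mono_left (nhdsWithin_le_nhds (s := Icc 0 u))
          simpa using this
        simpa [ContinuousWithinAt] using this
      · exact (hder t ⟨h, ht.2.trans_lt hu.2⟩).continuousAt.continuousWithinAt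
    have key := image_norm_le_of_norm_deriv_right_le_deriv_boundary' 
      (f := fun t : ℝ => t^2 • (X t - Y t)) (a := 0) (b := u) (f' := fun t => if t = 0 then 0 else t • (H (t, X t) - H (t, Y t)))
      (B := fun t => L / 2 * M * t^2) (B' := fun t => L * M * t) hc ?_ (by simp) ?_ ?_ ?_ (right_mem_Icc.2 hu.1.le)
    · simp only [norm_smul, norm_pow, Real.norm_eq_abs, sq_abs] at key
      have : 0 < u^2 := by have := hu.1; positivity
      nlinarith
    · intro t ht
      rcases eq_or_lt_of_le ht.1 with h | h
      · subst h
        simp only [if_true]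
        rw [hasDerivWithinAt_iff_isLittleO]
        simp only [ne_eq, OfNat.ofNat_ne_zero, not_false_eq_true, zero_pow, zero_smul, sub_zero, smul_zero]
        have hO : (fun t : ℝ => t^2 • (X t - Y t)) =O[𝓝[Ici 0] 0] (fun t : ℝ => t^2) := by
          refine Asymptotics.IsBigO.of_bound M ?_
          have : Iio δ ∈ 𝓝[Ici 0] (0:ℝ) := mem_nhdsWithin_of_mem_nhds (Iio_mem_nhds (hu.1.trans hu.2))
          filter_upwards [self_mem_nhdsWithin, this] with t ht ht2
          rcases eq_or_lt_of_le (show (0:ℝ) ≤ t from ht) with h | h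
          · subst h; simp
          · rw [norm_smul, mul_comm]
            gcongr
            exact hM t ⟨h, ht2⟩
        refine hO.trans_isLittleO ?_
        have := (Asymptotics.isLittleO_pow_id (𝕜 := ℝ) (n := 2) (by norm_num))
        exact this.mono nhdsWithin_le_nhds
      · rw [if_neg h.ne']
        exact (hder t ⟨h, ht.2.trans hu.2⟩).hasDerivWithinAt
    · fun_prop
    · intro t ht
      have := ((hasDerivAt_pow 2 t).const_mul (L/2*M)).hasDerivWithinAt (s := Ici t)
      refine this.congr_deriv ?_
      simp; ring
    · intro t ht
      rcases eq_or_lt_of_le ht.1 with h | h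
      · subst h; simp
      · rw [if_neg h.ne', norm_smul, Real.norm_eq_abs, abs_of_pos h]
        have ht' : t ∈ Ioo 0 δ := ⟨h, ht.2.trans hu.2⟩
        have h1 := hlip t ⟨h.le, ht'.2.le.trans hδr⟩ _ (hX t ht') _ (hY t ht')
        have h2 := hM t ht'
        calc _ ≤ t * (L * ‖X t - Y t‖) := by gcongr
          _ ≤ t * (L * M) := by gcongr
          _ = _ := by ring
  have hn : ∀ n : ℕ, ∀ u ∈ Ioo 0 δ, ‖X u - Y u‖ ≤ (L/2)^n * (2 * r) := by
    intro n
    induction n with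
    | zero =>
      intro u hu
      have h1 := hX u hu
      have h2 := hY u hu
      rw [Metric.mem_closedBall] at h1 h2
      have := dist_triangle_right (X u) (Y u) X0
      rw [← dist_eq_norm]; simp; linarith
    | succ n ih =>
      intro u hu
      have := step _ ih u hu
      rw [pow_succ]; linarith
  intro u hu
  have ht : Tendsto (fun n : ℕ => (L/2)^n * (2 * r)) atTop (𝓝 (0 * (2*r))) :=
    (tendsto_pow_atTop_nhds_zero_of_lt_one (by linarith) (by linarith)).mul_const _
  have := ge_of_tendsto' ht (fun n => hn n u hu)
  rw [zero_mul] at this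
  exact sub_eq_zero.1 (norm_le_zero_iff.1 this)

theorem aux_exist {E : Type*} [NormedAddCommGroup E] [NormedSpace ℝ E] [CompleteSpace E]
    (H : ℝ × E → E) (X0 : E) (L r : ℝ) (hL0 : 0 ≤ L) (hL : L < 2) (hr : 0 < r)
    (hc : ContinuousOn H (Icc 0 r ×ˢ Metric.closedBall X0 r))
    (hlip : ∀ u ∈ Icc (0:ℝ) r, ∀ x ∈ Metric.closedBall X0 r, ∀ y ∈ Metric.closedBall X0 r,
        ‖H (u, x) - H (u, y)‖ ≤ L * ‖x - y‖) (h0 : H (0, X0) = (2:ℝ) • X0) :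
    ∃ ε > 0, ε ≤ r ∧ ∃ X : ℝ → E, Continuous X ∧ X 0 = X0 ∧
      (∀ u, X u ∈ Metric.closedBall X0 r) ∧
      ∀ u ∈ Ioo 0 ε, HasDerivAt X (u⁻¹ • (H (u, X u) - (2:ℝ) • X u)) u := by
  have hX0 : X0 ∈ Metric.closedBall X0 r := Metric.mem_closedBall_self hr.le
  have hcc : ContinuousWithinAt (fun t => H (t, X0)) (Icc 0 r) 0 := by
    have : ContinuousOn (fun t => H (t, X0)) (Icc 0 r) :=
      hc.comp (by fun_prop) (fun t ht => ⟨ht, hX0⟩)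
    exact this 0 ⟨le_rfl, hr.le⟩
  obtain ⟨η, hη, hη2⟩ := Metric.continuousWithinAt_iff.1 hcc ((2 - L) * r) (by nlinarith)
  set ε := min (η / 2) r with hε
  have hε0 : 0 < ε := by positivity
  have hεr : ε ≤ r := min_le_right _ _
  have hclose : ∀ t ∈ Icc 0 ε, ‖H (t, X0) - (2:ℝ) • X0‖ ≤ (2 - L) * r := by
    intro t ht
    rw [← h0, ← dist_eq_norm]
    refine (hη2 ⟨ht.1, ht.2.trans hεr⟩ ?_).le
    have : ε ≤ η / 2 := min_le_left _ _
    rw [Real.dist_eq, sub_zero, abs_of_nonneg ht.1]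
    linarith [ht.2]
  let P : ℝ → Icc 0 ε := projIcc 0 ε hε0.le
  have hPc : Continuous P := continuous_projIcc
  let s : Set C(Icc 0 ε, E) := Metric.closedBall (ContinuousMap.const _ X0) r
  have hmem : ∀ X : s, ∀ u, X.1 u ∈ Metric.closedBall X0 r := by
    intro X u
    have := X.2
    rw [Metric.mem_closedBall] at this ⊢
    exact (ContinuousMap.dist_apply_le_dist (g := ContinuousMap.const _ X0) u).trans this
  let g : s → ℝ → E := fun X t => H (P t, X.1 (P t))
  have hPr : ∀ t, (P t : ℝ) ∈ Icc 0 r := fun t => ⟨(P t).2.1, (P t).2.2.trans hεr⟩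
  have hg : ∀ X, Continuous (g X) := by
    intro X
    refine hc.comp_continuous (by fun_prop) (fun t => ⟨hPr t, hmem X _⟩)
  have hgb : ∀ X t, ‖g X t - (2:ℝ) • X0‖ ≤ 2 * r := by
    intro X t
    have h1 := hlip _ (hPr t) _ (hmem X (P t)) _ hX0
    have h2 := hclose _ (P t).2
    have h3 : ‖X.1 (P t) - X0‖ ≤ r := by
      rw [← dist_eq_norm]; exact hmem X _
    have h4 : L * ‖X.1 (P t) - X0‖ ≤ L * r := by gcongr
    have h5 := norm_sub_le_norm_sub_add_norm_sub (g X t) (H (P t, X0)) ((2:ℝ) • X0)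
    change ‖g X t - _‖ ≤ _ at h1
    linarith
  let J : s → ℝ → E := fun X u => ∫ τ in (0:ℝ)..1, τ • g X (τ * u)
  have hJc : ∀ X, Continuous (J X) := by
    intro X
    refine intervalIntegral.continuous_parametric_intervalIntegral_of_continuous' ?_ 0 1
    have := hg X
    fun_prop
  have hIntg : ∀ X u, IntervalIntegrable (fun τ : ℝ => τ • g X (τ * u)) MeasureTheory.volume 0 1 := by
    intro X u
    have := hg X
    exact Continuous.intervalIntegrable (by fun_prop) _ _
  have hbd : ∀ (f : ℝ → E) (C : ℝ), (∀ t, ‖f t‖ ≤ 2 * C) → ‖∫ τ in (0:ℝ)..1, τ • f τ‖ ≤ C := by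
    intro f C hf
    have : ‖∫ τ in (0:ℝ)..1, τ • f τ‖ ≤ ∫ τ in (0:ℝ)..1, τ * (2 * C) := by
      refine intervalIntegral.norm_integral_le_of_norm_le zero_le_one ?_ ?_
      · refine Eventually.of_forall fun t ht => ?_
        rw [norm_smul, Real.norm_eq_abs, abs_of_pos ht.1]
        exact mul_le_mul_of_nonneg_left (hf t) ht.1.le
      · exact Continuous.intervalIntegrable (by fun_prop) _ _
    refine this.trans (le_of_eq ?_)
    rw [intervalIntegral.integral_mul_const, integral_id]; ring
  have hhalf : ∀ x : E, ∫ τ in (0:ℝ)..1, τ • ((2:ℝ) • x) = x := by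
    intro x
    rw [intervalIntegral.integral_smul_const, integral_id, smul_smul]; norm_num
  have hJb : ∀ X u, J X u ∈ Metric.closedBall X0 r := by
    intro X u
    rw [Metric.mem_closedBall, dist_eq_norm]
    have : J X u - X0 = ∫ τ in (0:ℝ)..1, τ • (g X (τ * u) - (2:ℝ) • X0) := by
      conv_lhs => rw [← hhalf X0]
      simp only [J, smul_sub]
      rw [intervalIntegral.integral_sub (hIntg X u)]
      exact Continuous.intervalIntegrable (by fun_prop) _ _
    rw [this]
    exact hbd _ _ (fun t => hgb X _)
  let T : s → s := fun X => ⟨⟨fun u => J X u, by have := hJc X; fun_prop⟩, by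
    rw [Metric.mem_closedBall, ContinuousMap.dist_le hr.le]
    intro u
    exact hJb X u⟩
  have hT : ContractingWith (Real.toNNReal (L/2)) T := by
    constructor
    · rw [Real.toNNReal_lt_one]; linarith
    · refine LipschitzWith.of_dist_le_mul fun X Y => ?_
      rw [Real.coe_toNNReal _ (by linarith)]
      change dist (T X).1 (T Y).1 ≤ L/2 * dist X.1 Y.1
      rw [ContinuousMap.dist_le (by positivity)]
      intro u
      change dist (J X u) (J Y u) ≤ _
      rw [dist_eq_norm]
      have : J X u - J Y u = ∫ τ in (0:ℝ)..1, τ • (g X (τ * u) - g Y (τ * u)) := by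
        simp only [J, smul_sub]
        rw [intervalIntegral.integral_sub (hIntg X u) (hIntg Y u)]
      rw [this]
      refine hbd _ _ (fun t => ?_)
      have h1 := hlip _ (hPr (t*u)) _ (hmem X (P (t*u))) _ (hmem Y (P (t*u)))
      rw [← dist_eq_norm (X.1 _)] at h1
      have h2 := ContinuousMap.dist_apply_le_dist (f := X.1) (g := Y.1) (P (t*u))
      refine h1.trans ?_
      have : L * dist (X.1 (P (t*u))) (Y.1 (P (t*u))) ≤ L * dist X.1 Y.1 := by gcongr
      linarith
  have : CompleteSpace s := Metric.isClosed_closedBall.completeSpace_coe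
  have : Nonempty s := ⟨⟨_, Metric.mem_closedBall_self hr.le⟩⟩
  let X := hT.fixedPoint T
  have hX : T X = X := hT.fixedPoint_isFixedPt
  have hXJ : ∀ u (hu : u ∈ Icc 0 ε), J X u = X.1 ⟨u, hu⟩ := by
    intro u hu
    conv_rhs => rw [← hX]
    rfl
  refine ⟨ε, hε0, hεr, J X, hJc X, ?_, hJb X, ?_⟩
  ·
    have hz := hXJ 0 ⟨le_rfl, hε0.le⟩
    have hP0 : P 0 = ⟨0, ⟨le_rfl, hε0.le⟩⟩ := projIcc_left _
    have h1 : J X 0 = (1/2 : ℝ) • H (0, J X 0) := by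
      conv_lhs => simp only [J, mul_zero, g]
      rw [intervalIntegral.integral_smul_const, integral_id, hP0, ← hz]; norm_num
    have h2 := hlip 0 ⟨le_rfl, hr.le⟩ _ (hJb X 0) _ hX0
    have h3 : J X 0 - X0 = (1/2 : ℝ) • (H (0, J X 0) - H (0, X0)) := by
      rw [smul_sub, ← h1, h0, smul_smul]; norm_num
    have h4 : ‖J X 0 - X0‖ = 1/2 * ‖H (0, J X 0) - H (0, X0)‖ := by
      conv_lhs => rw [h3]
      rw [norm_smul]; norm_num
    have h5 : ‖J X 0 - X0‖ ≤ 0 := by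
      have := norm_nonneg (J X 0 - X0)
      nlinarith
    exact sub_eq_zero.1 (norm_le_zero_iff.1 h5)
  · intro u hu
    have hF : ∀ v, HasDerivAt (fun v => ∫ t in (0:ℝ)..v, t • g X t) (v • g X v) v := by
      intro v
      have : Continuous (fun t : ℝ => t • g X t) := by have := hg X; fun_prop
      exact this.integral_hasStrictDerivAt 0 v |>.hasDerivAt
    have hJF : ∀ v, 0 < v → J X v = (v^2)⁻¹ • ∫ t in (0:ℝ)..v, t • g X t := by
      intro v hv
      have h1 := intervalIntegral.integral_comp_mul_right (a := 0) (b := 1) (fun t : ℝ => t • g X t) hv.ne'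
      simp only [zero_mul, one_mul] at h1
      have h2 : ∫ τ in (0:ℝ)..1, (τ * v) • g X (τ * v) = v • J X v := by
        simp only [J]
        rw [← intervalIntegral.integral_smul]
        congr 1; ext t; rw [smul_smul, mul_comm]
      rw [h2] at h1
      have : J X v = v⁻¹ • (v • J X v) := by rw [smul_smul, inv_mul_cancel₀ hv.ne', one_smul]
      rw [this, h1, smul_smul]; congr 1; field_simp
    have hgu : g X u = H (u, J X u) := by
      have hu' : u ∈ Icc 0 ε := ⟨hu.1.le, hu.2.le⟩
      have : P u = ⟨u, hu'⟩ := projIcc_of_mem _ hu'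
      simp only [g, this, hXJ u hu']
    have hu0 : u ≠ 0 := hu.1.ne'
    have hd := ((hasDerivAt_pow 2 u).inv (pow_ne_zero 2 hu0)).smul (hF u)
    have hev : J X =ᶠ[𝓝 u] fun v => (v^2)⁻¹ • ∫ t in (0:ℝ)..v, t • g X t := by
      filter_upwards [Ioi_mem_nhds hu.1] with v hv using hJF v hv
    refine (HasDerivAt.congr_of_eventuallyEq (hd.congr_deriv ?_) hev)
    rw [← hgu, hJF u hu.1, smul_sub, smul_smul, smul_smul, smul_smul, sub_eq_add_neg, ← neg_smul]
    simp only [Pi.inv_apply]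
    congr 2
    · field_simp
    · field_simp
      simp; ring

theorem lin_zero (e k : ℝ → ℝ) (ε M : ℝ) (hc : ContinuousOn e (Ico 0 ε)) (h0 : e 0 = 0)
    (hd : ∀ u ∈ Ioo 0 ε, HasDerivAt e (k u * e u) u) (hk : ∀ u ∈ Ioo 0 ε, k u ≤ M) :
    ∀ u ∈ Ioo 0 ε, e u = 0 := by
  have hder : ∀ u ∈ Ioo 0 ε, HasDerivAt (fun u => e u ^ 2 * Real.exp (-(2 * M) * u))
      (2 * (k u - M) * (e u ^ 2 * Real.exp (-(2 * M) * u))) u := by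
    intro u hu
    have h1 := ((hd u hu).pow 2).mul (((hasDerivAt_id u).const_mul (-(2*M))).exp)
    refine h1.congr_deriv ?_
    simp; ring
  have hanti : AntitoneOn (fun u => e u ^ 2 * Real.exp (-(2 * M) * u)) (Ico 0 ε) := by
    apply antitoneOn_of_deriv_nonpos (convex_Ico 0 ε)
    · exact (hc.pow 2).mul (by fun_prop)
    · intro u hu
      rw [interior_Ico] at hu
      exact (hder u hu).differentiableAt.differentiableWithinAt
    · intro u hu
      rw [interior_Ico] at hu
      rw [(hder u hu).deriv]
      have := hk u hu
      have h2 : 0 ≤ e u ^ 2 * Real.exp (-(2 * M) * u) := by positivity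
      nlinarith
  intro u hu
  have := hanti ⟨le_rfl, hu.1.trans hu.2⟩ ⟨hu.1.le, hu.2⟩ hu.1.le
  simp only [h0] at this
  have h3 := Real.exp_pos (-(2 * M) * u)
  have h4 : e u ^ 2 ≤ 0 := by
    by_contra h
    push Not at h
    have := mul_pos h h3
    norm_num at *
    linarith
  exact pow_eq_zero_iff (two_ne_zero) |>.1 (le_antisymm h4 (sq_nonneg _))

noncomputable def w1x (a1 a2 a3 a4 z : ℝ) : ℝ := 1/2 * (a1^2 * z * a3) / (a2^2 * a4^2)
noncomputable def w2x (a1 a2 a3 a4 z : ℝ) : ℝ := 1/2 * ((z + a3) / a4 - a1 / a2)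
noncomputable def w4x (a1 a2 a3 a4 z : ℝ) : ℝ := 1/2 * ((a3 - z) / a2 + a1 / a4)
noncomputable def ipx (a1 a2 a3 a4 z : ℝ) : ℝ :=
  w1x a1 a2 a3 a4 z * a1 + w2x a1 a2 a3 a4 z * a2 + V3 a1 a2 a3 a4 * a3 + w4x a1 a2 a3 a4 z * a4

noncomputable def HC (a1 a2 a3 a4 p q r c z u l : ℝ) : ℝ × ℝ × ℝ × ℝ × ℝ :=
  (p + (w1x a1 a2 a3 a4 z - ipx a1 a2 a3 a4 z * a1),
   q + l * (w2x a1 a2 a3 a4 z - ipx a1 a2 a3 a4 z * a2),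
   r + l * (w4x a1 a2 a3 a4 z - ipx a1 a2 a3 a4 z * a4),
   c + (V3 a1 a2 a3 a4 - ipx a1 a2 a3 a4 z * a3),
   2 * z + 2 * (a1 - z * V3 a1 a2 a3 a4) / c - u * ipx a1 a2 a3 a4 z * z)

noncomputable def HH (m l : ℝ) (y : ℝ × (ℝ × ℝ × ℝ × ℝ × ℝ)) : ℝ × ℝ × ℝ × ℝ × ℝ :=
  HC (m + y.1 * y.2.1) (l + y.1 * y.2.2.1 / l) (y.1 * y.2.2.2.2.1) (l + y.1 * y.2.2.2.1 / l)
    y.2.1 y.2.2.1 y.2.2.2.1 y.2.2.2.2.1 y.2.2.2.2.2 y.1 l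

noncomputable def X0x (m : ℝ) : ℝ × ℝ × ℝ × ℝ × ℝ := (0, -m/4, m/4, 2, m/2)

theorem HH_zero (m l : ℝ) (hl : 0 < l) (p q r c z : ℝ) :
    HH m l (0, p, q, r, c, z) = (p, q + (z - m)/2, r + (m - z)/2, c + 2, 2*z + 2*(m-2*z)/c) := by
  have : l ≠ 0 := hl.ne'
  simp only [HH, HC, ipx, w1x, w2x, w4x, V3, Prod.mk.injEq]
  refine ⟨?_, ?_, ?_, ?_, ?_⟩ <;> simp <;> field_simp <;> (ring_nf; try simp)

theorem HH_X0 (m l : ℝ) (hl : 0 < l) : HH m l (0, X0x m) = (2:ℝ) • X0x m := by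
  rw [X0x, HH_zero m l hl]
  simp only [Prod.smul_mk, smul_eq_mul, Prod.mk.injEq]
  refine ⟨?_, ?_, ?_, ?_, ?_⟩ <;> ring

theorem HH_smooth (m l : ℝ) (hl : 0 < l) : ContDiffAt ℝ 1 (HH m l) (0, X0x m) := by
  have : l ≠ 0 := hl.ne'
  unfold HH HC ipx w1x w2x w4x V3 X0x
  fun_prop (disch := simp [this])

theorem HH_deriv (m l : ℝ) (hl : 0 < l) : ∃ A : (ℝ × ℝ × ℝ × ℝ × ℝ) →L[ℝ] (ℝ × ℝ × ℝ × ℝ × ℝ),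
    HasFDerivAt (fun x => HH m l (0, x)) A (X0x m) ∧ ‖A‖ < 2 := by
  have hd : DifferentiableAt ℝ (fun x => HH m l (0, x)) (X0x m) := by
    have h1 := (HH_smooth m l hl).differentiableAt one_ne_zero
    exact DifferentiableAt.comp (X0x m) (f := fun x => ((0:ℝ), x)) h1 (by fun_prop)
  refine ⟨_, hd.hasFDerivAt, ?_⟩
  suffices h : ‖fderiv ℝ (fun x => HH m l (0, x)) (X0x m)‖ ≤ 3/2 by linarith
  refine ContinuousLinearMap.opNorm_le_bound _ (by norm_num) ?_
  rintro ⟨p, q, r, c, z⟩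
  have hline : HasDerivAt (fun t : ℝ => X0x m + t • ((p, q, r, c, z) : ℝ × ℝ × ℝ × ℝ × ℝ)) (p, q, r, c, z) 0 := by
    have := ((hasDerivAt_id (0:ℝ)).smul_const ((p, q, r, c, z) : ℝ × ℝ × ℝ × ℝ × ℝ)).const_add (X0x m)
    simpa using this
  have hd' : HasFDerivAt (fun x => HH m l (0, x)) (fderiv ℝ (fun x => HH m l (0, x)) (X0x m))
      (X0x m + (0:ℝ) • ((p, q, r, c, z) : ℝ × ℝ × ℝ × ℝ × ℝ)) := by
    simpa using hd.hasFDerivAt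
  have h1 := hd'.comp_hasDerivAt 0 hline
  have h2 : HasDerivAt (fun t : ℝ => HH m l (0, X0x m + t • ((p, q, r, c, z) : ℝ × ℝ × ℝ × ℝ × ℝ)))
     (p, q + z/2, r - z/2, c, 0) 0 := by
    simp only [X0x, Prod.smul_mk, Prod.mk_add_mk, HH_zero m l hl, smul_eq_mul]
    have hid := hasDerivAt_id (0:ℝ)
    refine HasDerivAt.prodMk ?_ (HasDerivAt.prodMk ?_ (HasDerivAt.prodMk ?_ (HasDerivAt.prodMk ?_ ?_)))
    · simpa using (hid.mul_const p)
    · have := ((hid.mul_const q).const_add (-m/4)).add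
        ((((hid.mul_const z).const_add (m/2)).sub_const m).div_const 2)
      refine this.congr_deriv ?_
      simp
    · have := ((hid.mul_const r).const_add (m/4)).add
        ((((hid.mul_const z).const_add (m/2)).const_sub m).div_const 2)
      refine this.congr_deriv ?_
      simp; ring
    · simpa using ((hid.mul_const c).const_add 2).add_const 2
    · have hz := (hid.mul_const z).const_add (m/2)
      have hcc := (hid.mul_const c).const_add 2
      have := (hz.const_mul 2).add ((((hz.const_mul 2).const_sub m).const_mul 2).div hcc (by simp))
      refine this.congr_deriv ?_
      simp; ring
  have h3 := h1.unique h2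
  rw [h3]
  simp only [Prod.norm_def, Real.norm_eq_abs]
  set N := max |p| (max |q| (max |r| (max |c| |z|))) with hN
  have hp : |p| ≤ N := by simp [hN]
  have hq : |q| ≤ N := by simp [hN]
  have hr : |r| ≤ N := by simp [hN]
  have hc : |c| ≤ N := by simp [hN]
  have hz : |z| ≤ N := by simp [hN]
  rw [abs_le] at hp hq hr hc hz
  refine max_le ?_ (max_le ?_ (max_le ?_ (max_le ?_ ?_))) <;> rw [abs_le] <;> constructor <;> linarith

theorem W_eq (a1 a2 a3 a4 z : ℝ) (h2 : 0 < a2) (h3 : 0 < a3) (h4 : 0 < a4)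
    (hz : z * a3 = a4^2 - a2^2) :
    V1 a1 a2 a3 a4 = w1x a1 a2 a3 a4 z ∧ V2 a1 a2 a3 a4 = w2x a1 a2 a3 a4 z ∧
    V4 a1 a2 a3 a4 = w4x a1 a2 a3 a4 z ∧ ipVS a1 a2 a3 a4 = ipx a1 a2 a3 a4 z := by
  have e1 : V1 a1 a2 a3 a4 = w1x a1 a2 a3 a4 z := by
    unfold V1 w1x; field_simp; linear_combination (-a1^2) * hz
  have e2 : V2 a1 a2 a3 a4 = w2x a1 a2 a3 a4 z := by
    unfold V2 w2x; field_simp; linear_combination (-a2) * hz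
  have e4 : V4 a1 a2 a3 a4 = w4x a1 a2 a3 a4 z := by
    unfold V4 w4x; field_simp; linear_combination (a4) * hz
  refine ⟨e1, e2, e4, ?_⟩
  unfold ipVS ipx
  rw [e1, e2, e4]

theorem exist_main (m l : ℝ) (hm : 0 < m) (hl : 0 < l) (hml : m^2 + 2*l^2 = 1)
    (ε : ℝ) (hε : 0 < ε) (p q r c z : ℝ → ℝ)
    (hp : Continuous p) (hq : Continuous q) (hr : Continuous r) (hc : Continuous c) (hz : Continuous z)
    (h0 : (p 0, q 0, r 0, c 0, z 0) = X0x m)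
    (hode : ∀ u ∈ Ioo 0 ε, HasDerivAt (fun u => (p u, q u, r u, c u, z u))
      (u⁻¹ • (HH m l (u, p u, q u, r u, c u, z u) - (2:ℝ) • (p u, q u, r u, c u, z u))) u) :
    ∃ δ > 0, δ ≤ ε ∧ ∃ a1 a2 a3 a4 : ℝ → ℝ, 
      (∀ u, a1 u = m + u * p u) ∧ (∀ u, a2 u = l + u * q u / l) ∧ (∀ u, a4 u = l + u * r u / l) ∧
      (∀ u, a3 u = u * c u) ∧ 
      ∀ u ∈ Ioo 0 δ,
        (a1 u)^2 + (a2 u)^2 + (a3 u)^2 + (a4 u)^2 = 1 ∧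
        HasDerivAt a1 (W1 (a1 u) (a2 u) (a3 u) (a4 u)) u ∧
        HasDerivAt a2 (W2 (a1 u) (a2 u) (a3 u) (a4 u)) u ∧
        HasDerivAt a3 (W3 (a1 u) (a2 u) (a3 u) (a4 u)) u ∧
        HasDerivAt a4 (W4 (a1 u) (a2 u) (a3 u) (a4 u)) u ∧
        0 < a3 u ∧ 0 < a2 u ∧ a2 u < a4 u := by
  simp only [X0x, Prod.mk.injEq] at h0
  obtain ⟨hp0, hq0, hr0, hc0, hz0⟩ := h0
  have hl' : l ≠ 0 := hl.ne'
  obtain ⟨a1, ha1⟩ : ∃ a1 : ℝ → ℝ, a1 = fun u => m + u * p u := ⟨_, rfl⟩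
  obtain ⟨a2, ha2⟩ : ∃ a2 : ℝ → ℝ, a2 = fun u => l + u * q u / l := ⟨_, rfl⟩
  obtain ⟨a4, ha4⟩ : ∃ a4 : ℝ → ℝ, a4 = fun u => l + u * r u / l := ⟨_, rfl⟩
  obtain ⟨a3, ha3⟩ : ∃ a3 : ℝ → ℝ, a3 = fun u => u * c u := ⟨_, rfl⟩
  have c1 : Continuous a1 := by rw [ha1]; fun_prop
  have c2 : Continuous a2 := by rw [ha2]; fun_prop
  have c3 : Continuous a3 := by rw [ha3]; fun_prop
  have c4 : Continuous a4 := by rw [ha4]; fun_prop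
  have b1 : a1 0 = m := by simp [ha1]
  have b2 : a2 0 = l := by simp [ha2]
  have b3 : a3 0 = 0 := by simp [ha3]
  have b4 : a4 0 = l := by simp [ha4]
  have n2 : a2 0 ≠ 0 := by rw [b2]; exact hl'
  have n4 : a4 0 ≠ 0 := by rw [b4]; exact hl'
  set K : ℝ → ℝ := fun u => ipx (a1 u) (a2 u) (a3 u) (a4 u) (z u) with hK
  have hKc : ContinuousAt K 0 := by
    simp only [hK, ipx, w1x, w2x, w4x, V3]
    fun_prop (disch := simp [n2, n4])
  set k : ℝ → ℝ := fun u => a3 u / (a2 u * a4 u) - 2 * K u with hk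
  have hkc : ContinuousAt k 0 := by
    simp only [hk]
    fun_prop (disch := simp [n2, n4])
  have ev : ∀ᶠ u in 𝓝 (0:ℝ), 0 < a2 u ∧ 0 < a4 u ∧ 0 < c u ∧ 0 < z u ∧ k u < k 0 + 1 ∧ -2 * K u < -2 * K 0 + 1 := by
    refine ((c2.continuousAt.eventually_const_lt (by rw [b2]; exact hl)).and
      ((c4.continuousAt.eventually_const_lt (by rw [b4]; exact hl)).and
      ((hc.continuousAt.eventually_const_lt (by rw [hc0]; norm_num)).and
      ((hz.continuousAt.eventually_const_lt (by rw [hz0]; linarith)).and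
      ((hkc.eventually_lt_const (by linarith)).and 
      ((hKc.const_mul (-2)).eventually_lt_const (by linarith)))))))
  obtain ⟨η, hη, hev⟩ := Metric.eventually_nhds_iff.1 ev
  set δ := min η ε with hδ
  have hδε : δ ≤ ε := min_le_right _ _
  have hevI : ∀ u ∈ Ioo 0 δ, 0 < a2 u ∧ 0 < a4 u ∧ 0 < c u ∧ 0 < z u ∧ k u < k 0 + 1 ∧ -2 * K u < -2 * K 0 + 1 := by
    intro u hu
    apply hev
    rw [Real.dist_eq, sub_zero, abs_of_pos hu.1]
    exact hu.2.trans_le (min_le_left _ _)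
  have hder : ∀ u ∈ Ioo 0 δ, 
      HasDerivAt a1 (w1x (a1 u) (a2 u) (a3 u) (a4 u) (z u) - K u * a1 u) u ∧
      HasDerivAt a2 (w2x (a1 u) (a2 u) (a3 u) (a4 u) (z u) - K u * a2 u) u ∧
      HasDerivAt a4 (w4x (a1 u) (a2 u) (a3 u) (a4 u) (z u) - K u * a4 u) u ∧
      HasDerivAt a3 (V3 (a1 u) (a2 u) (a3 u) (a4 u) - K u * a3 u) u ∧
      HasDerivAt z (2 * (a1 u - z u * V3 (a1 u) (a2 u) (a3 u) (a4 u)) / a3 u - K u * z u) u := by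
    intro u hu
    have hu0 : u ≠ 0 := hu.1.ne'
    have h := hode u ⟨hu.1, hu.2.trans_le hδε⟩
    have e1 : m + u * p u = a1 u := by rw [ha1]
    have e2 : l + u * q u / l = a2 u := by rw [ha2]
    have e4 : l + u * r u / l = a4 u := by rw [ha4]
    have e3 : u * c u = a3 u := by rw [ha3]
    have hcu := (hevI u hu).2.2.1
    simp only [HH, e1, e2, e3, e4, HC] at h
    have d1 : HasDerivAt p _ u := h.fst
    have d2 : HasDerivAt q _ u := h.snd.fst
    have d4 : HasDerivAt r _ u := h.snd.snd.fst
    have d3 : HasDerivAt c _ u := h.snd.snd.snd.fst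
    have d5 : HasDerivAt z _ u := h.snd.snd.snd.snd
    simp only [Prod.smul_mk, Prod.mk_sub_mk, smul_eq_mul] at d1 d2 d3 d4 d5
    refine ⟨?_, ?_, ?_, ?_, ?_⟩
    · have := ((hasDerivAt_id u).mul d1).const_add m
      rw [ha1] 
      refine this.congr_deriv ?_
      rw [← ha1]
      simp only [hK, id]
      field_simp; ring
    · have := (((hasDerivAt_id u).mul d2).div_const l).const_add l
      rw [ha2] 
      refine this.congr_deriv ?_
      rw [← ha2]
      simp only [hK, id]
      field_simp; ring
    · have := (((hasDerivAt_id u).mul d4).div_const l).const_add l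
      rw [ha4] 
      refine this.congr_deriv ?_
      rw [← ha4]
      simp only [hK, id]
      field_simp; ring
    · have := (hasDerivAt_id u).mul d3
      rw [ha3] 
      refine this.congr_deriv ?_
      rw [← ha3]
      simp only [hK, id]
      field_simp; ring
    · refine d5.congr_deriv ?_
      simp only [hK]
      rw [← e3]
      field_simp; ring
  have he : ∀ u ∈ Ioo 0 δ, a4 u ^ 2 - a2 u ^ 2 - z u * a3 u = 0 := by
    refine lin_zero _ k δ (k 0 + 1) (Continuous.continuousOn (by fun_prop)) (by simp [b2, b3, b4]) ?_
      (fun u hu => (hevI u hu).2.2.2.2.1.le)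
    intro u hu
    obtain ⟨d1, d2, d4, d3, d5⟩ := hder u hu
    have p2 := (hevI u hu).1
    have p4 := (hevI u hu).2.1
    have p3 : 0 < a3 u := by rw [ha3]; exact mul_pos hu.1 (hevI u hu).2.2.1
    have := ((d4.pow 2).sub (d2.pow 2)).sub (d5.mul d3)
    refine this.congr_deriv ?_
    simp only [hk]
    generalize K u = KK
    simp only [w2x, w4x, V3]
    generalize a1 u = A1 at *
    generalize a2 u = A2 at *
    generalize a3 u = A3 at *
    generalize a4 u = A4 at *
    generalize z u = Z at *
    simp
    field_simp
    ring
  have hq1 : ∀ u ∈ Ioo 0 δ, a1 u ^ 2 + a2 u ^ 2 + a3 u ^ 2 + a4 u ^ 2 - 1 = 0 := by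
    refine lin_zero _ (fun u => -2 * K u) δ (-2 * K 0 + 1) (Continuous.continuousOn (by fun_prop))
      (by simp [b1, b2, b3, b4]; linarith) ?_
      (fun u hu => (hevI u hu).2.2.2.2.2.le)
    intro u hu
    obtain ⟨d1, d2, d4, d3, d5⟩ := hder u hu
    have := ((((d1.pow 2).add (d2.pow 2)).add (d3.pow 2)).add (d4.pow 2)).sub_const 1
    refine this.congr_deriv ?_
    have hKu : K u = ipx (a1 u) (a2 u) (a3 u) (a4 u) (z u) := rfl
    simp only [ipx] at hKu
    simp
    linear_combination -2 * hKu
  refine ⟨δ, by positivity, hδε, a1, a2, a3, a4, fun u => by rw [ha1], fun u => by rw [ha2], 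
    fun u => by rw [ha4], fun u => by rw [ha3], ?_⟩
  intro u hu
  obtain ⟨d1, d2, d4, d3, d5⟩ := hder u hu
  have p2 := (hevI u hu).1
  have p4 := (hevI u hu).2.1
  have p3 : 0 < a3 u := by rw [ha3]; exact mul_pos hu.1 (hevI u hu).2.2.1
  have pz := (hevI u hu).2.2.2.1
  have heu := he u hu
  obtain ⟨E1, E2, E4, E5⟩ := W_eq (a1 u) (a2 u) (a3 u) (a4 u) (z u) p2 p3 p4 (by linarith)
  refine ⟨by linarith [hq1 u hu], ?_, ?_, ?_, ?_, p3, p2, ?_⟩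
  · rw [W1, E1, E5]; exact d1
  · rw [W2, E2, E5]; exact d2
  · rw [W3, E5]; exact d3
  · rw [W4, E4, E5]; exact d4
  · have := mul_pos pz p3
    nlinarith

/-- bundle of properties of a trajectory -/
def IsTraj (ε : ℝ) (b1 b2 b3 b4 : ℝ → ℝ) : Prop :=
  ∀ u ∈ Set.Ioo 0 ε,
          (b1 u)^2 + (b2 u)^2 + (b3 u)^2 + (b4 u)^2 = 1 ∧
          HasDerivAt b1 (W1 (b1 u) (b2 u) (b3 u) (b4 u)) u ∧
          HasDerivAt b2 (W2 (b1 u) (b2 u) (b3 u) (b4 u)) u ∧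
          HasDerivAt b3 (W3 (b1 u) (b2 u) (b3 u) (b4 u)) u ∧
          HasDerivAt b4 (W4 (b1 u) (b2 u) (b3 u) (b4 u)) u ∧
          0 < b3 u ∧ 0 < b2 u ∧ b2 u < b4 u

theorem traj_D {ε : ℝ} {b1 b2 b3 b4 : ℝ → ℝ} (h : IsTraj ε b1 b2 b3 b4) (u : ℝ) (hu : u ∈ Ioo 0 ε) :
    HasDerivAt (fun u => b4 u ^ 2 - b2 u ^ 2) (2 * b1 u - (b4 u ^ 2 - b2 u ^ 2) / b3 u *
      (V3 (b1 u) (b2 u) (b3 u) (b4 u) + 2 * ipVS (b1 u) (b2 u) (b3 u) (b4 u) * b3 u)) u := by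
  obtain ⟨-, d1, d2, d3, d4, p3, p2, p4⟩ := h u hu
  have p4 := p2.trans p4
  have := (d4.pow 2).sub (d2.pow 2)
  refine this.congr_deriv ?_
  simp only [W2, W4]
  generalize ipVS (b1 u) (b2 u) (b3 u) (b4 u) = K
  simp only [V2, V3, V4]
  field_simp
  simp
  ring

theorem traj_ode {ε : ℝ} {b1 b2 b3 b4 : ℝ → ℝ} (m l : ℝ) (hl : 0 < l) (h : IsTraj ε b1 b2 b3 b4)
    (p q r c z : ℝ → ℝ) (hp : p = fun u => (b1 u - m) / u) (hq : q = fun u => l * (b2 u - l) / u)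
    (hr : r = fun u => l * (b4 u - l) / u) (hc : c = fun u => b3 u / u)
    (hz : z = fun u => (b4 u ^ 2 - b2 u ^ 2) / b3 u) :
    ∀ u ∈ Ioo 0 ε, HasDerivAt (fun u => (p u, q u, r u, c u, z u))
      (u⁻¹ • (HH m l (u, p u, q u, r u, c u, z u) - (2:ℝ) • (p u, q u, r u, c u, z u))) u := by
  intro u hu
  have dD := traj_D h u hu
  obtain ⟨-, d1, d2, d3, d4, p3, p2, p4⟩ := h u hu
  have p4 := p2.trans p4
  have hu0 : u ≠ 0 := hu.1.ne'
  have hl0 : l ≠ 0 := hl.ne'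
  have ez : z u * b3 u = b4 u ^ 2 - b2 u ^ 2 := by rw [hz]; field_simp
  obtain ⟨E1, E2, E4, E5⟩ := W_eq (b1 u) (b2 u) (b3 u) (b4 u) (z u) p2 p3 p4 ez
  rw [W1, E1, E5] at d1
  rw [W2, E2, E5] at d2
  rw [W3, E5] at d3
  rw [W4, E4, E5] at d4
  rw [← ez, E5] at dD
  have e1 : m + u * p u = b1 u := by rw [hp]; field_simp; ring
  have e2 : l + u * q u / l = b2 u := by rw [hq]; field_simp; ring
  have e4 : l + u * r u / l = b4 u := by rw [hr]; field_simp; ring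
  have e3 : u * c u = b3 u := by rw [hc]; field_simp
  have c0 : c u ≠ 0 := by rw [hc]; positivity
  simp only [HH, e1, e2, e3, e4, HC, Prod.smul_mk, Prod.mk_sub_mk, smul_eq_mul]
  generalize ipx (b1 u) (b2 u) (b3 u) (b4 u) (z u) = K at *
  have hid := hasDerivAt_id u
  refine HasDerivAt.prodMk ?_ (HasDerivAt.prodMk ?_ (HasDerivAt.prodMk ?_ (HasDerivAt.prodMk ?_ ?_)))
  · rw [hp]
    refine ((d1.sub_const m).div hid hu0).congr_deriv ?_
    simp only [id]; field_simp; ring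
  · rw [hq]
    refine (((d2.sub_const l).const_mul l).div hid hu0).congr_deriv ?_
    simp only [id]; field_simp; ring
  · rw [hr]
    refine (((d4.sub_const l).const_mul l).div hid hu0).congr_deriv ?_
    simp only [id]; field_simp; ring
  · rw [hc]
    refine (d3.div hid hu0).congr_deriv ?_
    simp only [id]; field_simp; ring
  · have := dD.div d3 p3.ne'
    have hz' : z = (fun u => b4 u ^ 2 - b2 u ^ 2) / b3 := hz
    rw [← hz'] at this
    refine this.congr_deriv ?_
    rw [← ez, ← e3]
    field_simp; ring

theorem traj_lim {ε : ℝ} {b1 b2 b3 b4 : ℝ → ℝ} (m l : ℝ) (hm : 0 < m) (hl : 0 < l) (hε : 0 < ε)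
    (h : IsTraj ε b1 b2 b3 b4)
    (ht : Tendsto (fun u => (b1 u, b2 u, b3 u, b4 u)) (𝓝[>] 0) (𝓝 (m, l, (0:ℝ), l)))
    (p q r c z : ℝ → ℝ) (hp : p = fun u => (b1 u - m) / u) (hq : q = fun u => l * (b2 u - l) / u)
    (hr : r = fun u => l * (b4 u - l) / u) (hc : c = fun u => b3 u / u)
    (hz : z = fun u => (b4 u ^ 2 - b2 u ^ 2) / b3 u) :
    Tendsto (fun u => (p u, q u, r u, c u, z u)) (𝓝[>] 0) (𝓝 (X0x m)) := by
  have hl0 : l ≠ 0 := hl.ne'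
  have t1 : Tendsto b1 (𝓝[>] 0) (𝓝 m) := ht.fst_nhds
  have t2 : Tendsto b2 (𝓝[>] 0) (𝓝 l) := ht.snd_nhds.fst_nhds
  have t3 : Tendsto b3 (𝓝[>] 0) (𝓝 0) := ht.snd_nhds.snd_nhds.fst_nhds
  have t4 : Tendsto b4 (𝓝[>] 0) (𝓝 l) := ht.snd_nhds.snd_nhds.snd_nhds
  have hI : ∀ᶠ u in 𝓝[>] (0:ℝ), u ∈ Ioo 0 ε := Ioo_mem_nhdsGT hε
  have tid : Tendsto (fun u : ℝ => u) (𝓝[>] 0) (𝓝 0) := tendsto_id.mono_left nhdsWithin_le_nhds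
  have tD : Tendsto (fun u => b4 u ^ 2 - b2 u ^ 2) (𝓝[>] 0) (𝓝 0) := by
    simpa using (t4.pow 2).sub (t2.pow 2)
  have tV3 : Tendsto (fun u => V3 (b1 u) (b2 u) (b3 u) (b4 u)) (𝓝[>] 0) (𝓝 2) := by
    have : ContinuousAt (fun y : ℝ × ℝ × ℝ × ℝ => V3 y.1 y.2.1 y.2.2.1 y.2.2.2) (m, l, 0, l) := by
      unfold V3; fun_prop (disch := simp [hl0])
    have h2 := this.tendsto.comp ht
    have e : V3 m l 0 l = 2 := by unfold V3; field_simp; ring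
    rw [← e]; exact h2
  have tK : Tendsto (fun u => ipVS (b1 u) (b2 u) (b3 u) (b4 u) * b3 u) (𝓝[>] 0) (𝓝 0) := by
    have : ContinuousAt (fun y : ℝ × ℝ × ℝ × ℝ => V1 y.1 y.2.1 y.2.2.1 y.2.2.2 * y.1 * y.2.2.1 +
        V3 y.1 y.2.1 y.2.2.1 y.2.2.2 * y.2.2.1 ^ 2 + (-(y.2.2.2^2 - y.2.1^2)^2 + y.2.2.1^2 * (y.2.1^2+y.2.2.2^2)) /
          (2 * y.2.1 * y.2.2.2)) (m, l, 0, l) := by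
      unfold V1 V3; fun_prop (disch := simp [hl0])
    have h2 := this.tendsto.comp ht
    have e : V1 m l 0 l * m * 0 + V3 m l 0 l * 0^2 + (-(l^2-l^2)^2 + 0^2*(l^2+l^2))/(2*l*l) = 0 := by simp
    simp only [e] at h2
    refine Tendsto.congr' ?_ h2
    filter_upwards [hI] with u hu
    obtain ⟨-, d1, d2, d3, d4, p3, p2, p4⟩ := h u hu
    have p4 := p2.trans p4
    simp only [Function.comp, ipVS]
    generalize V1 (b1 u) (b2 u) (b3 u) (b4 u) = x1
    generalize V3 (b1 u) (b2 u) (b3 u) (b4 u) = x3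
    simp only [V2, V4]
    field_simp
    ring
  have tκ : Tendsto (fun u => V3 (b1 u) (b2 u) (b3 u) (b4 u) + 2 * ipVS (b1 u) (b2 u) (b3 u) (b4 u) * b3 u)
      (𝓝[>] 0) (𝓝 2) := by
    have := tV3.add (tK.const_mul 2)
    simpa [mul_assoc] using this
  have lh : ∀ (f f' : ℝ → ℝ) (y : ℝ), (∀ u ∈ Ioo 0 ε, HasDerivAt f (f' u) u) → Tendsto f (𝓝[>] 0) (𝓝 0) →
      Tendsto f' (𝓝[>] 0) (𝓝 y) → Tendsto (fun u => f u / u) (𝓝[>] 0) (𝓝 y) := by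
    intro f f' y h1 h2 h3
    refine HasDerivAt.lhopital_zero_nhdsGT (f' := f') (g' := fun _ => 1) (g := fun u => u) (hI.mono h1)
      (Eventually.of_forall fun u => hasDerivAt_id u) (by simp) h2 tid (by simpa using h3)
  have tc : Tendsto c (𝓝[>] 0) (𝓝 2) := by
    rw [hc]
    refine lh _ _ _ (fun u hu => (h u hu).2.2.2.1) t3 ?_
    unfold W3
    simpa using tV3.sub tK
  have hDb : ∀ᶠ u in 𝓝[>] (0:ℝ), |(b4 u ^ 2 - b2 u ^ 2) / u| ≤ 3 * m := by
    have ev : ∀ᶠ u in 𝓝[>] (0:ℝ), b1 u < 3/2 * m ∧ 0 < V3 (b1 u) (b2 u) (b3 u) (b4 u) + 2 * ipVS (b1 u) (b2 u) (b3 u) (b4 u) * b3 u :=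
      (t1.eventually_lt_const (by linarith)).and (tκ.eventually_const_lt (by norm_num))
    obtain ⟨δ, hδ, hev⟩ := mem_nhdsGT_iff_exists_Ioo_subset.1 (inter_mem ev hI)
    have hder : ∀ u ∈ Ioo 0 δ, HasDerivAt (fun u => 3 * m * u - (b4 u ^ 2 - b2 u ^ 2)) _ u := fun u hu =>
      ((hasDerivAt_id u).const_mul (3*m)).sub (traj_D h u (hev hu).2)
    have hmono : MonotoneOn (fun u => 3 * m * u - (b4 u ^ 2 - b2 u ^ 2)) (Ioo 0 δ) := by
      apply monotoneOn_of_deriv_nonneg (convex_Ioo 0 δ)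
      · exact fun u hu => (hder u hu).continuousAt.continuousWithinAt
      · intro u hu
        rw [interior_Ioo] at hu
        exact (hder u hu).differentiableAt.differentiableWithinAt
      · intro u hu
        rw [interior_Ioo] at hu
        rw [(hder u hu).deriv]
        obtain ⟨⟨g1, g2⟩, hu2⟩ := hev hu
        obtain ⟨-, d1, d2, d3, d4, p3, p2, p4⟩ := h u hu2
        have hD : 0 < b4 u ^ 2 - b2 u ^ 2 := by nlinarith
        have := mul_pos (div_pos hD p3) g2
        linarith
    have hlim0 : Tendsto (fun u => 3 * m * u - (b4 u ^ 2 - b2 u ^ 2)) (𝓝[>] 0) (𝓝 0) := by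
      simpa using (tid.const_mul (3*m)).sub tD
    filter_upwards [Ioo_mem_nhdsGT hδ] with u hu
    obtain ⟨-, d1, d2, d3, d4, p3, p2, p4⟩ := h u (hev hu).2
    have hD : 0 < b4 u ^ 2 - b2 u ^ 2 := by nlinarith
    rw [abs_of_pos (div_pos hD hu.1), div_le_iff₀ hu.1]
    have : 0 ≤ 3 * m * u - (b4 u ^ 2 - b2 u ^ 2) := by
      refine le_of_tendsto hlim0 ?_
      filter_upwards [Ioo_mem_nhdsGT hu.1] with t ht
      exact hmono ⟨ht.1, ht.2.trans hu.2⟩ hu ht.2.le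
    linarith
  have tDu : Tendsto (fun u => (b4 u ^ 2 - b2 u ^ 2) / u) (𝓝[>] 0) (𝓝 m) := by
    have key : Tendsto (fun u => (u * (b4 u ^ 2 - b2 u ^ 2)) / u^2) (𝓝[>] 0) (𝓝 m) := by
      refine HasDerivAt.lhopital_zero_nhdsGT (g' := fun u => 2 * u) (g := fun u => u^2) 
        (f := fun u => (u * (b4 u ^ 2 - b2 u ^ 2)))
        (hI.mono fun u hu => (hasDerivAt_id u).mul (traj_D h u hu)) ?_ ?_ ?_ ?_ ?_
      · exact Eventually.of_forall fun u => by simpa using hasDerivAt_pow 2 u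
      · filter_upwards [hI] with u hu
        have := hu.1
        positivity
      · simpa using tid.mul tD
      · simpa using tid.pow 2
      · have hs : Tendsto (fun u => (b4 u ^ 2 - b2 u ^ 2) / u * (1 - (V3 (b1 u) (b2 u) (b3 u) (b4 u) + 2 * ipVS (b1 u) (b2 u) (b3 u) (b4 u) * b3 u) / c u)) (𝓝[>] 0) (𝓝 0) := by
          have h1 : Tendsto (fun u => 3 * m * |1 - (V3 (b1 u) (b2 u) (b3 u) (b4 u) + 2 * ipVS (b1 u) (b2 u) (b3 u) (b4 u) * b3 u) / c u|) (𝓝[>] 0) (𝓝 0) := by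
            have := (((tκ.div tc (by norm_num)).const_sub 1).abs).const_mul (3*m)
            simpa using this
          refine squeeze_zero_norm' ?_ h1
          filter_upwards [hDb] with u hu
          rw [norm_mul, Real.norm_eq_abs, Real.norm_eq_abs]
          gcongr
        have := t1.add (hs.div_const 2)
        simp only [zero_div, add_zero] at this
        refine this.congr' ?_
        filter_upwards [hI] with u hu
        have p3 := (h u hu).2.2.2.2.2.1
        have hu1 := hu.1
        generalize V3 (b1 u) (b2 u) (b3 u) (b4 u) + 2 * ipVS (b1 u) (b2 u) (b3 u) (b4 u) * b3 u = κ
        rw [hc]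
        simp only [id]
        field_simp
        ring
    refine key.congr' ?_
    filter_upwards [hI] with u hu
    have hu1 := hu.1
    field_simp
  have tz : Tendsto z (𝓝[>] 0) (𝓝 (m/2)) := by
    refine (tDu.div tc (by norm_num)).congr' ?_
    filter_upwards [hI] with u hu
    have p3 := (h u hu).2.2.2.2.2.1
    have hu1 := hu.1
    simp only [hc, hz, Pi.div_apply]
    field_simp
  have tall : Tendsto (fun u => (b1 u, b2 u, b3 u, b4 u, z u)) (𝓝[>] 0) (𝓝 (m, l, 0, l, m/2)) :=
    t1.prodMk_nhds (t2.prodMk_nhds (t3.prodMk_nhds (t4.prodMk_nhds tz)))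
  have hE : ∀ u ∈ Ioo 0 ε, _ := fun u hu => W_eq (b1 u) (b2 u) (b3 u) (b4 u) (z u) (h u hu).2.2.2.2.2.2.1
    (h u hu).2.2.2.2.2.1 ((h u hu).2.2.2.2.2.2.1.trans (h u hu).2.2.2.2.2.2.2) (by
      have p3 := (h u hu).2.2.2.2.2.1
      rw [hz]; field_simp)
  have tp : Tendsto p (𝓝[>] 0) (𝓝 0) := by
    rw [hp]
    refine lh _ _ _ (fun u hu => (h u hu).2.1.sub_const m) (by simpa using t1.sub_const m) ?_
    have : ContinuousAt (fun y : ℝ × ℝ × ℝ × ℝ × ℝ => w1x y.1 y.2.1 y.2.2.1 y.2.2.2.1 y.2.2.2.2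
      - ipx y.1 y.2.1 y.2.2.1 y.2.2.2.1 y.2.2.2.2 * y.1) (m, l, 0, l, m/2) := by
      unfold ipx w1x w2x w4x V3; fun_prop (disch := simp [hl0])
    have h2 := this.tendsto.comp tall
    have e : w1x m l 0 l (m/2) - ipx m l 0 l (m/2) * m = 0 := by
      simp only [ipx, w1x, w2x, w4x, V3]; field_simp; ring
    simp only [e] at h2
    refine h2.congr' ?_
    filter_upwards [hI] with u hu
    obtain ⟨E1, E2, E4, E5⟩ := hE u hu
    simp only [Function.comp, W1, E1, E5]
  have tq : Tendsto q (𝓝[>] 0) (𝓝 (-m/4)) := by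
    have : Tendsto (fun u => (b2 u - l) / u) (𝓝[>] 0) (𝓝 (-m/(4*l))) := by
      refine lh _ _ _ (fun u hu => (h u hu).2.2.1.sub_const l) (by simpa using t2.sub_const l) ?_
      have : ContinuousAt (fun y : ℝ × ℝ × ℝ × ℝ × ℝ => w2x y.1 y.2.1 y.2.2.1 y.2.2.2.1 y.2.2.2.2
        - ipx y.1 y.2.1 y.2.2.1 y.2.2.2.1 y.2.2.2.2 * y.2.1) (m, l, 0, l, m/2) := by
        unfold ipx w1x w2x w4x V3; fun_prop (disch := simp [hl0])
      have h2 := this.tendsto.comp tall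
      have e : w2x m l 0 l (m/2) - ipx m l 0 l (m/2) * l = -m/(4*l) := by
        simp only [ipx, w1x, w2x, w4x, V3]; field_simp; ring
      simp only [e] at h2
      refine h2.congr' ?_
      filter_upwards [hI] with u hu
      obtain ⟨E1, E2, E4, E5⟩ := hE u hu
      simp only [Function.comp, W2, E2, E5]
    have h3 := this.const_mul l
    rw [hq]
    convert h3 using 2
    · ring
    · field_simp
  have tr : Tendsto r (𝓝[>] 0) (𝓝 (m/4)) := by
    have : Tendsto (fun u => (b4 u - l) / u) (𝓝[>] 0) (𝓝 (m/(4*l))) := by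
      refine lh _ _ _ (fun u hu => (h u hu).2.2.2.2.1.sub_const l) (by simpa using t4.sub_const l) ?_
      have : ContinuousAt (fun y : ℝ × ℝ × ℝ × ℝ × ℝ => w4x y.1 y.2.1 y.2.2.1 y.2.2.2.1 y.2.2.2.2
        - ipx y.1 y.2.1 y.2.2.1 y.2.2.2.1 y.2.2.2.2 * y.2.2.2.1) (m, l, 0, l, m/2) := by
        unfold ipx w1x w2x w4x V3; fun_prop (disch := simp [hl0])
      have h2 := this.tendsto.comp tall
      have e : w4x m l 0 l (m/2) - ipx m l 0 l (m/2) * l = m/(4*l) := by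
        simp only [ipx, w1x, w2x, w4x, V3]; field_simp; ring
      simp only [e] at h2
      refine h2.congr' ?_
      filter_upwards [hI] with u hu
      obtain ⟨E1, E2, E4, E5⟩ := hE u hu
      simp only [Function.comp, W4, E4, E5]
    have h3 := this.const_mul l
    rw [hr]
    convert h3 using 2
    · ring
    · field_simp
  exact tp.prodMk_nhds (tq.prodMk_nhds (tr.prodMk_nhds (tc.prodMk_nhds tz)))

theorem Wv_smooth (S : ℝ × ℝ × ℝ × ℝ) (h2 : 0 < S.2.1) (h3 : 0 < S.2.2.1) (h4 : 0 < S.2.2.2) :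
    ContDiffAt ℝ 1 Wv S := by
  have := h2.ne'
  have := h3.ne'
  have := h4.ne'
  unfold Wv W1 W2 W3 W4 ipVS V1 V2 V3 V4
  fun_prop (disch := simp [*])

theorem traj_vec {ε : ℝ} {b1 b2 b3 b4 : ℝ → ℝ} (h : IsTraj ε b1 b2 b3 b4) (u : ℝ) (hu : u ∈ Ioo 0 ε) :
    HasDerivAt (fun u => (b1 u, b2 u, b3 u, b4 u)) (Wv (b1 u, b2 u, b3 u, b4 u)) u := by
  obtain ⟨-, d1, d2, d3, d4, -⟩ := h u hu
  exact d1.prodMk (d2.prodMk (d3.prodMk d4))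

theorem traj_cont {ε : ℝ} {a1 a2 a3 a4 b1 b2 b3 b4 : ℝ → ℝ} (ha : IsTraj ε a1 a2 a3 a4)
    (hb : IsTraj ε b1 b2 b3 b4) (δ : ℝ) (hδ : 0 < δ) (hδε : δ ≤ ε)
    (heq : ∀ u ∈ Ioo 0 δ, (a1 u, a2 u, a3 u, a4 u) = (b1 u, b2 u, b3 u, b4 u)) :
    ∀ u ∈ Ioo 0 ε, (a1 u, a2 u, a3 u, a4 u) = (b1 u, b2 u, b3 u, b4 u) := by
  set f := fun u => (a1 u, a2 u, a3 u, a4 u) with hf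
  set g := fun u => (b1 u, b2 u, b3 u, b4 u) with hg
  have key : Ioo 0 ε ⊆ {t | ∀ᶠ s in 𝓝 t, f s = g s} := by
    refine isPreconnected_Ioo.subset_of_closure_inter_subset isOpen_setOfPred_eventually_nhds ?_ ?_
    · refine ⟨δ/2, ⟨by linarith, by linarith⟩, ?_⟩
      filter_upwards [Ioo_mem_nhds (show 0 < δ/2 by linarith) (show δ/2 < δ by linarith)] with s hs
      exact heq s hs
    · rintro t ⟨htc, ht⟩
      have df := traj_vec ha t ht
      have dg := traj_vec hb t ht
      have e : f t = g t := by
        by_contra hne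
        have h1 := (df.continuousAt.ne_iff_eventually_ne dg.continuousAt).1 hne
        obtain ⟨s, hs1, hs2⟩ := ((mem_closure_iff_frequently.1 htc).and_eventually h1).exists
        exact hs2 hs1.self_of_nhds
      obtain ⟨-, -, -, -, -, p3, p2, p4⟩ := ha t ht
      obtain ⟨K, s, hs, hK⟩ := (Wv_smooth (f t) p2 p3 (p2.trans p4)).exists_lipschitzOnWith
      have hI : ∀ᶠ u in 𝓝 t, u ∈ Ioo 0 ε := Ioo_mem_nhds ht.1 ht.2
      refine ODE_solution_unique_of_eventually (v := fun _ => Wv) (s := fun _ => s) (K := K)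
        (Eventually.of_forall fun _ => hK) ?_ ?_ e
      · filter_upwards [hI, df.continuousAt.eventually_mem hs] with u hu hu2
        exact ⟨traj_vec ha u hu, hu2⟩
      · have hs' : s ∈ 𝓝 (g t) := by rw [← e]; exact hs
        filter_upwards [hI, dg.continuousAt.eventually_mem hs'] with u hu hu2
        exact ⟨traj_vec hb u hu, hu2⟩
  intro u hu
  exact (key hu).self_of_nhds

theorem IsTraj.mono {ε ε' : ℝ} {b1 b2 b3 b4 : ℝ → ℝ} (h : IsTraj ε b1 b2 b3 b4) (he : ε' ≤ ε) :
    IsTraj ε' b1 b2 b3 b4 := fun u hu => h u ⟨hu.1, hu.2.trans_le he⟩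

/-- Lemma 4: existence and uniqueness of the trajectory of system (6)
coming out of the point `S₀ = (μ, λ, 0, λ)` into the region
`α₃ > 0, α₄ > α₂ > 0`. -/
theorem statement13 (m l : ℝ) (hm : 0 < m) (hl : 0 < l) (hml : m^2 + 2*l^2 = 1) :
    ∃ ε > (0:ℝ), ∃ a1 a2 a3 a4 : ℝ → ℝ,
      (∀ u ∈ Set.Ioo 0 ε,
        (a1 u)^2 + (a2 u)^2 + (a3 u)^2 + (a4 u)^2 = 1 ∧
        HasDerivAt a1 (W1 (a1 u) (a2 u) (a3 u) (a4 u)) u ∧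
        HasDerivAt a2 (W2 (a1 u) (a2 u) (a3 u) (a4 u)) u ∧
        HasDerivAt a3 (W3 (a1 u) (a2 u) (a3 u) (a4 u)) u ∧
        HasDerivAt a4 (W4 (a1 u) (a2 u) (a3 u) (a4 u)) u ∧
        0 < a3 u ∧ 0 < a2 u ∧ a2 u < a4 u) ∧
      Filter.Tendsto (fun u => (a1 u, a2 u, a3 u, a4 u))
        (nhdsWithin 0 (Set.Ioi 0)) (nhds (m, l, (0:ℝ), l)) ∧
      (∀ ε' > (0:ℝ), ∀ b1 b2 b3 b4 : ℝ → ℝ,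
        (∀ u ∈ Set.Ioo 0 ε',
          (b1 u)^2 + (b2 u)^2 + (b3 u)^2 + (b4 u)^2 = 1 ∧
          HasDerivAt b1 (W1 (b1 u) (b2 u) (b3 u) (b4 u)) u ∧
          HasDerivAt b2 (W2 (b1 u) (b2 u) (b3 u) (b4 u)) u ∧
          HasDerivAt b3 (W3 (b1 u) (b2 u) (b3 u) (b4 u)) u ∧
          HasDerivAt b4 (W4 (b1 u) (b2 u) (b3 u) (b4 u)) u ∧
          0 < b3 u ∧ 0 < b2 u ∧ b2 u < b4 u) →
        Filter.Tendsto (fun u => (b1 u, b2 u, b3 u, b4 u))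
          (nhdsWithin 0 (Set.Ioi 0)) (nhds (m, l, (0:ℝ), l)) →
        ∀ u ∈ Set.Ioo 0 (min ε ε'),
          a1 u = b1 u ∧ a2 u = b2 u ∧ a3 u = b3 u ∧ a4 u = b4 u) := by
  have hl0 : l ≠ 0 := hl.ne'
  obtain ⟨A, hA, hA2⟩ := HH_deriv m l hl
  obtain ⟨L, hL0, hL2, ρ, hρ, hcont, hlip⟩ := aux_lip (HH m l) (X0x m) A (HH_smooth m l hl) hA hA2
  obtain ⟨ε, hε, hερ, X, hXc, hX0, hXb, hXd⟩ := aux_exist (HH m l) (X0x m) L ρ hL0 hL2 hρ hcont hlip (HH_X0 m l hl)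
  obtain ⟨δ, hδ, hδε, a1, a2, a3, a4, e1, e2, e4, e3, htraj⟩ := exist_main m l hm hl hml ε hε
    (fun u => (X u).1) (fun u => (X u).2.1) (fun u => (X u).2.2.1) (fun u => (X u).2.2.2.1) (fun u => (X u).2.2.2.2)
    (by fun_prop) (by fun_prop) (by fun_prop) (by fun_prop) (by fun_prop) hX0 hXd
  have htend : Filter.Tendsto (fun u => (a1 u, a2 u, a3 u, a4 u))
        (nhdsWithin 0 (Set.Ioi 0)) (nhds (m, l, (0:ℝ), l)) := by
    have hc : Continuous (fun u => (a1 u, a2 u, a3 u, a4 u)) := by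
      simp only [e1, e2, e3, e4]; fun_prop
    have := (hc.tendsto 0).mono_left (nhdsWithin_le_nhds (s := Ioi 0))
    simpa [e1, e2, e3, e4] using this
  refine ⟨δ, hδ, a1, a2, a3, a4, htraj, htend, ?_⟩
  intro ε' hε' b1 b2 b3 b4 hb htb
  have hb' : IsTraj ε' b1 b2 b3 b4 := hb
  have ha' : IsTraj δ a1 a2 a3 a4 := htraj
  have hode := traj_ode m l hl hb' _ _ _ _ _ rfl rfl rfl rfl rfl
  have hlim := traj_lim m l hm hl hε' hb' htb _ _ _ _ _ rfl rfl rfl rfl rfl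
  obtain ⟨η, hη, hball⟩ := mem_nhdsGT_iff_exists_Ioo_subset.1
    (hlim.eventually_mem (Metric.closedBall_mem_nhds (X0x m) hρ))
  have hη : 0 < η := hη
  set κ := min η (min δ ε') with hκ
  have hκ0 : 0 < κ := by positivity
  have k1 : κ ≤ η := min_le_left _ _
  have k2 : κ ≤ min δ ε' := min_le_right _ _
  have k3 : κ ≤ δ := k2.trans (min_le_left _ _)
  have k4 : κ ≤ ε' := k2.trans (min_le_right _ _)
  have huniq := aux_uniq (HH m l) (X0x m) L ρ κ hL0 hL2 (k3.trans (hδε.trans hερ)) hlip X _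
    (fun u _ => hXb u) (fun u hu => hball ⟨hu.1, hu.2.trans_le k1⟩)
    (fun u hu => hXd u ⟨hu.1, hu.2.trans_le (k3.trans hδε)⟩)
    (fun u hu => hode u ⟨hu.1, hu.2.trans_le k4⟩)
  have hfin := traj_cont (ha'.mono (min_le_left δ ε')) (hb'.mono (min_le_right δ ε')) κ hκ0 k2 (by
    intro u hu
    have h := huniq u hu
    have hu0 : u ≠ 0 := hu.1.ne'
    rw [e1, e2, e3, e4, h]
    simp only [Prod.mk.injEq]
    refine ⟨?_, ?_, ?_, ?_⟩ <;> field_simp <;> ring)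
  intro u hu
  have := hfin u hu
  simpa only [Prod.mk.injEq] using this

end
end
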